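/- arXiv:2010.05311 — 2 statements merged into one kernel-verified Lean document; each statement's English description precedes it below -/
import Mathlib

section
/- For every integer T ≥ 1, every k ∈ [0,1], and every x ∈ [0,1]^T, one has the explicit bound |p_T(k, x) − D⁰(x)| ≤ (1 − k)·T·(T − 1)/2. -/
/-- `pRec k x t` is the recursion `p₁ = x₁`, `p_{τ+1} = (1 + k (x_{τ+1} − 1)) p_τ + x_{τ+1}`
(with the harmless convention `p₀ = 0`, which makes the recursion also produce `p₁ = x₁`). -/
noncomputable def pRec (k : ℝ) (x : ℕ → ℝ) : ℕ → ℝ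
  | 0 => 0
  | t + 1 => (1 + k * (x (t + 1) - 1)) * pRec k x t + x (t + 1)

/-- `qRec k x t` is the recursion `q₁ = 1 − x₁`, `q_{τ+1} = (1 − k x_{τ+1}) q_τ + (1 − x_{τ+1})`. -/
noncomputable def qRec (k : ℝ) (x : ℕ → ℝ) : ℕ → ℝ
  | 0 => 0
  | t + 1 => (1 - k * x (t + 1)) * qRec k x t + (1 - x (t + 1))

/-- The persistent change filter `D(k, x) = p_T − q_T`. -/
noncomputable def Dfilter (k : ℝ) (x : ℕ → ℝ) (T : ℕ) : ℝ :=
  pRec k x T - qRec k x T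

/-- `D⁰(x) = Σ_{i=1}^T Π_{j=1}^i x_{T−j+1}`. -/
noncomputable def D0 (T : ℕ) (x : ℕ → ℝ) : ℝ :=
  ∑ i ∈ Finset.Icc 1 T, ∏ j ∈ Finset.Icc 1 i, x (T - j + 1)

lemma Finset.prod_Icc_one_eq_prod_range {M : Type*} [CommMonoid M] (f : ℕ → M) (n : ℕ) :
    ∏ j ∈ Finset.Icc 1 n, f j = ∏ j ∈ Finset.range n, f (j + 1) := by
  induction n with
  | zero => simp
  | succ n ih => rw [Finset.prod_Icc_succ_top (by omega), ih, Finset.prod_range_succ]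

lemma Finset.sum_Icc_one_eq_sum_range {M : Type*} [AddCommMonoid M] (f : ℕ → M) (n : ℕ) :
    ∑ j ∈ Finset.Icc 1 n, f j = ∑ j ∈ Finset.range n, f (j + 1) := by
  induction n with
  | zero => simp
  | succ n ih => rw [Finset.sum_Icc_succ_top (by omega), ih, Finset.sum_range_succ]

lemma D0_succ (t : ℕ) (x : ℕ → ℝ) : D0 (t + 1) x = x (t + 1) * (1 + D0 t x) := by
  simp only [D0, Finset.sum_Icc_one_eq_sum_range, Finset.prod_Icc_one_eq_prod_range,
    Nat.add_sub_add_right]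
  simp_rw [Finset.prod_range_succ' _ (_ : ℕ)]
  rw [← Finset.sum_mul, Finset.sum_range_succ']
  simp only [Finset.prod_range_succ', Finset.prod_range_zero, Nat.sub_zero]
  ring

lemma pRec_mem_Icc {k : ℝ} (hk : k ∈ Set.Icc (0 : ℝ) 1) {x : ℕ → ℝ} {t : ℕ}
    (hx : ∀ τ ∈ Finset.Icc 1 t, x τ ∈ Set.Icc (0 : ℝ) 1) :
    pRec k x t ∈ Set.Icc (0 : ℝ) t := by
  induction t with
  | zero => simp [pRec]
  | succ t ih =>
    obtain ⟨hp0, hpt⟩ := ih fun τ hτ => hx τ (Finset.Icc_subset_Icc_right t.le_succ hτ)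
    obtain ⟨hx0, hx1⟩ := hx (t + 1) (by simp)
    obtain ⟨hk0, hk1⟩ := hk
    have hc : 0 ≤ k * (1 - x (t + 1)) := mul_nonneg hk0 (by linarith)
    have hc' : k * (1 - x (t + 1)) ≤ 1 := mul_le_one₀ hk1 (by linarith) (by linarith)
    have h₁ := mul_nonneg hc hp0
    have h₂ := mul_nonneg (sub_nonneg.2 hc') hp0
    simp only [pRec, Set.mem_Icc]
    push_cast
    constructor <;> linarith

lemma abs_pRec_sub_D0_le_of_mem_Icc {k : ℝ} (hk : k ∈ Set.Icc (0 : ℝ) 1) {x : ℕ → ℝ} {t : ℕ}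
    (hx : ∀ τ ∈ Finset.Icc 1 t, x τ ∈ Set.Icc (0 : ℝ) 1) :
    |pRec k x t - D0 t x| ≤ (1 - k) * t * ((t : ℝ) - 1) / 2 := by
  induction t with
  | zero => simp [pRec, D0]
  | succ t ih =>
    have hx' : ∀ τ ∈ Finset.Icc 1 t, x τ ∈ Set.Icc (0 : ℝ) 1 := fun τ hτ =>
      hx τ (Finset.Icc_subset_Icc_right t.le_succ hτ)
    obtain ⟨hp0, hpt⟩ := pRec_mem_Icc hk hx'
    obtain ⟨hx0, hx1⟩ := hx (t + 1) (by simp)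
    have hk1 : 0 ≤ 1 - k := sub_nonneg.2 hk.2
    have hx1' : 0 ≤ 1 - x (t + 1) := sub_nonneg.2 hx1
    have step : pRec k x (t + 1) - D0 (t + 1) x =
        x (t + 1) * (pRec k x t - D0 t x) + (1 - k) * ((1 - x (t + 1)) * pRec k x t) := by
      rw [D0_succ, pRec]
      ring
    calc |pRec k x (t + 1) - D0 (t + 1) x|
        ≤ x (t + 1) * |pRec k x t - D0 t x| + (1 - k) * ((1 - x (t + 1)) * pRec k x t) := by
          rw [step]
          refine (abs_add_le _ _).trans_eq ?_
          rw [abs_mul, abs_of_nonneg hx0,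
            abs_of_nonneg (mul_nonneg hk1 (mul_nonneg hx1' hp0))]
      _ ≤ 1 * ((1 - k) * t * ((t : ℝ) - 1) / 2) + (1 - k) * (1 * t) := by
          gcongr
          · exact ih hx'
          · linarith
      _ = (1 - k) * (t + 1 : ℕ) * (((t + 1 : ℕ) : ℝ) - 1) / 2 := by
          push_cast
          ring

/-- Explicit bound: |p_T(k, x) - D0(x)| <= (1 - k) * T * (T - 1) / 2
for k in [0,1], x in [0,1]^T. -/
theorem abs_pRec_sub_D0_le (T : ℕ) (hT : 1 ≤ T) (k : ℝ) (hk : k ∈ Set.Icc (0 : ℝ) 1)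
    (x : ℕ → ℝ) (hx : ∀ τ ∈ Finset.Icc 1 T, x τ ∈ Set.Icc (0 : ℝ) 1) :
    |pRec k x T - D0 T x| ≤ (1 - k) * T * ((T : ℝ) - 1) / 2 :=
  abs_pRec_sub_D0_le_of_mem_Icc hk hx
end

section
/- Let T ≥ 1, let 0 ≤ t_0 ≤ T be an integer, and consider the step time series x_t = 1 if t > T − t_0 and x_t = 0 otherwise. Then for every k ∈ [0,1], p_T(k, x) = t_0 and q_T(k, x) = (1 − k)^{t_0}·(T − t_0); hence D(k, x) = t_0 − (1 − k)^{t_0}·(T − t_0). In particular, at k = 1 (and t_0 ≥ 1), D(1, x) = t_0, so the persistent change filter exactly recovers the duration of the persistent change. -/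
/-- On an initial stretch of zeros, `p` vanishes and `q` counts the steps. -/
theorem pRec_qRec_of_eq_zero (k : ℝ) (x : ℕ → ℝ) (n : ℕ) (h : ∀ t, 1 ≤ t → t ≤ n → x t = 0) :
    pRec k x n = 0 ∧ qRec k x n = n := by
  induction n with
  | zero => simp [pRec, qRec]
  | succ n ih =>
    obtain ⟨hp, hq⟩ := ih fun t h1 h2 => h t h1 (by omega)
    simp [pRec, qRec, hp, hq, h (n + 1) (by omega) le_rfl]

/-- On a stretch of `m` ones, `p` grows by `m` and `q` decays by the factor `(1 - k) ^ m`. -/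
theorem pRec_qRec_add_of_eq_one (k : ℝ) (x : ℕ → ℝ) (n m : ℕ)
    (h : ∀ t, n < t → t ≤ n + m → x t = 1) :
    pRec k x (n + m) = pRec k x n + m ∧ qRec k x (n + m) = (1 - k) ^ m * qRec k x n := by
  induction m with
  | zero => simp
  | succ m ih =>
    obtain ⟨hp, hq⟩ := ih fun t h1 h2 => h t h1 (by omega)
    have hx : x (n + m + 1) = 1 := h _ (by omega) (by omega)
    rw [← add_assoc, pRec, qRec, hp, hq, hx]
    push_cast
    constructor <;> ring

/-- For the step series x_t = 1[t > T - t0] and any k in [0,1]: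
p_T = t0, q_T = (1-k)^t0 * (T - t0), hence D(k,x) = t0 - (1-k)^t0 * (T - t0);
in particular D(1,x) = t0 when t0 >= 1. -/
theorem Dfilter_step_series (T t₀ : ℕ) (hT : 1 ≤ T) (ht₀ : t₀ ≤ T)
    (x : ℕ → ℝ) (hx : ∀ t, x t = if T - t₀ < t then 1 else 0)
    (k : ℝ) (hk : k ∈ Set.Icc (0 : ℝ) 1) :
    pRec k x T = t₀ ∧
    qRec k x T = (1 - k) ^ t₀ * ((T : ℝ) - t₀) ∧
    Dfilter k x T = (t₀ : ℝ) - (1 - k) ^ t₀ * ((T : ℝ) - t₀) ∧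
    (1 ≤ t₀ → Dfilter 1 x T = t₀) := by
  have key (c : ℝ) : pRec c x T = t₀ ∧ qRec c x T = (1 - c) ^ t₀ * ((T : ℝ) - t₀) := by
    obtain ⟨hp, hq⟩ := pRec_qRec_of_eq_zero c x (T - t₀) fun t _ h => by
      rw [hx, if_neg (by omega)]
    obtain ⟨hp', hq'⟩ := pRec_qRec_add_of_eq_one c x (T - t₀) t₀ fun t h _ => by
      rw [hx, if_pos h]
    rw [Nat.sub_add_cancel ht₀] at hp' hq'
    rw [hp', hq', hp, hq, Nat.cast_sub ht₀]
    simp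
  refine ⟨(key k).1, (key k).2, by rw [Dfilter, (key k).1, (key k).2], fun h => ?_⟩
  rw [Dfilter, (key 1).1, (key 1).2, sub_self, zero_pow (by omega), zero_mul, sub_zero]
end
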